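/- arXiv:2004.03058 — 2 statements merged into one kernel-verified Lean document; each statement's English description precedes it below -/
import Mathlib

section
/- Let s ∈ M_m be maximal and let ρ = ρ(s). Then for every monic irreducible polynomial p in F[x] of degree d with r = mult_p(s) (possibly r = 0), one has (ρ + 1)/(r + 2) ≤ d; and if r ≥ 1 then moreover d < (ρ + 1)/r. Equivalently, for every monic irreducible factor p of s, mult_p(s) ∈ {⌊ρ/deg p⌋, ⌊ρ/deg p⌋ − 1}. -/
open Polynomial

/-- `Φ(s)`: the number of distinct monic divisors of `s` in `F[x]`. -/
noncomputable def numDiv {F : Type} [Field F] (s : F[X]) : ℕ :=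
  Set.ncard {d : F[X] | d.Monic ∧ d ∣ s}

/-- `s` is maximal in `M_m`: `s` is monic of degree exactly `m` and `Φ(s) = Υ_m`. -/
def IsMaximal {F : Type} [Field F] (m : ℕ) (s : F[X]) : Prop :=
  s.Monic ∧ s.natDegree = m ∧
    ∀ t : F[X], t.Monic → t.natDegree ≤ m → numDiv t ≤ numDiv s

/-- `ρ(s)`: the maximum multiplicity in `s` of a monic polynomial of degree 1. -/
noncomputable def rho {F : Type} [Field F] (s : F[X]) : ℕ :=
  sSup {r : ℕ | ∃ p : F[X], p.Monic ∧ p.natDegree = 1 ∧ r = multiplicity p s}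

section
variable {F : Type} [Field F]

/-- Splitting off a power of a monic irreducible polynomial multiplies the number of monic
divisors accordingly. -/
theorem numDiv_pow_mul {p u : F[X]} (hp : p.Monic) (hpi : Irreducible p) (hpu : ¬ p ∣ u)
    (k : ℕ) : numDiv (p ^ k * u) = (k + 1) * numDiv u := by
  have hset : {d : F[X] | d.Monic ∧ d ∣ p ^ k * u} =
      (fun x : ℕ × F[X] => p ^ x.1 * x.2) '' (Set.Iic k ×ˢ {d : F[X] | d.Monic ∧ d ∣ u}) := by
    ext d
    simp only [Set.mem_ofPred_eq, Set.mem_image, Set.mem_prod, Set.mem_Iic, Prod.exists]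
    constructor
    · rintro ⟨hd, hdvd⟩
      obtain ⟨a, b, ha, hb, rfl⟩ := exists_dvd_and_dvd_of_dvd_mul hdvd
      obtain ⟨i, hi, hai⟩ := (dvd_prime_pow hpi.prime k).1 ha
      obtain ⟨c, rfl⟩ := hai.symm
      refine ⟨i, c * b, ⟨hi, ?_, ?_⟩, by ring⟩
      · rw [mul_assoc] at hd
        exact (hp.pow i).of_mul_monic_left hd
      · exact (Units.isUnit c).mul_left_dvd.2 hb
    · rintro ⟨i, y, ⟨hi, hy, hyu⟩, rfl⟩
      exact ⟨(hp.pow i).mul hy, mul_dvd_mul (pow_dvd_pow p hi) hyu⟩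
  have hinj : Set.InjOn (fun x : ℕ × F[X] => p ^ x.1 * x.2)
      (Set.Iic k ×ˢ {d : F[X] | d.Monic ∧ d ∣ u}) := by
    have le_of_eq : ∀ {i j : ℕ} {y z : F[X]}, z ∣ u → p ^ i * y = p ^ j * z → i ≤ j := by
      intro i j y z hz h
      by_contra! hij
      obtain ⟨n, rfl⟩ := Nat.exists_eq_add_of_lt hij
      have h' : p ^ j * (p * (p ^ n * y)) = p ^ j * z := by rw [← h]; ring
      exact hpu ((Dvd.intro _ (mul_left_cancel₀ (pow_ne_zero j hp.ne_zero) h')).trans hz)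
    rintro ⟨i, y⟩ ⟨-, -, hy⟩ ⟨j, z⟩ ⟨-, -, hz⟩ h
    obtain rfl : i = j := le_antisymm (le_of_eq hz h) (le_of_eq hy h.symm)
    exact Prod.ext rfl (mul_left_cancel₀ (pow_ne_zero i hp.ne_zero) h)
  rw [numDiv, hset, hinj.ncard_image, Set.ncard_prod, numDiv]
  congr 1
  rw [← Finset.coe_Iic, Set.ncard_coe_finset, Nat.card_Iic]

theorem numDiv_pos [Finite F] {u : F[X]} (hu : u ≠ 0) : 0 < numDiv u := by
  have : Finite (degreeLT F (u.natDegree + 1)) := Module.finite_of_finite F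
  have hfin : {d : F[X] | d.Monic ∧ d ∣ u}.Finite := by
    refine (Set.toFinite (degreeLT F (u.natDegree + 1) : Set F[X])).subset ?_
    rintro d ⟨-, hd⟩
    refine mem_degreeLT.2 ((degree_le_of_dvd hd hu).trans_lt ?_)
    rw [degree_eq_natDegree hu]
    exact_mod_cast Nat.lt_succ_self _
  exact (Set.ncard_pos hfin).2 ⟨1, monic_one, one_dvd u⟩

theorem not_dvd_of_monic_irreducible {p l : F[X]} (hp : p.Monic) (hpi : Irreducible p)
    (hl : l.Monic) (hli : Irreducible l) (h : p ≠ l) : ¬ p ∣ l := fun hd =>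
  h (eq_of_monic_of_associated hp hl (hpi.associated_of_dvd hli hd))

theorem exists_eq_pow_multiplicity_mul {p s : F[X]} (hp : p.Monic) (hpi : Irreducible p)
    (hs : s.Monic) : ∃ u : F[X], u.Monic ∧ ¬ p ∣ u ∧ s = p ^ multiplicity p s * u := by
  obtain ⟨u, h, hu⟩ := (FiniteMultiplicity.of_prime_left hpi.prime
    hs.ne_zero).exists_eq_pow_mul_and_not_dvd
  exact ⟨u, (hp.pow _).of_mul_monic_left (h ▸ hs), hu, h⟩

theorem multiplicity_pow_mul_eq {p l u : F[X]} (hl : Irreducible l) (hu : u ≠ 0)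
    (hp : p ≠ 0) (hlp : ¬ l ∣ p) (k : ℕ) : multiplicity l (p ^ k * u) = multiplicity l u := by
  rw [multiplicity_mul hl.prime
    (FiniteMultiplicity.of_prime_left hl.prime (mul_ne_zero (pow_ne_zero k hp) hu)),
    multiplicity_eq_zero.2 (fun h => hlp (hl.prime.dvd_of_dvd_pow h)), zero_add]

theorem multiplicity_le_natDegree {p s : F[X]} (hp : p.natDegree = 1) (hs : s ≠ 0) :
    multiplicity p s ≤ s.natDegree := by
  simpa [natDegree_pow, hp] using natDegree_le_of_dvd (pow_multiplicity_dvd p s) hs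

theorem bddAbove_multiplicity_linear {s : F[X]} (hs : s ≠ 0) :
    BddAbove {r : ℕ | ∃ p : F[X], p.Monic ∧ p.natDegree = 1 ∧ r = multiplicity p s} := by
  refine ⟨s.natDegree, ?_⟩
  rintro r ⟨p, -, hp, rfl⟩
  exact multiplicity_le_natDegree hp hs

theorem multiplicity_le_rho {p s : F[X]} (hp : p.Monic) (hd : p.natDegree = 1) (hs : s ≠ 0) :
    multiplicity p s ≤ rho s :=
  le_csSup (bddAbove_multiplicity_linear hs) ⟨p, hp, hd, rfl⟩

theorem exists_multiplicity_eq_rho {s : F[X]} (hs : s ≠ 0) :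
    ∃ l : F[X], l.Monic ∧ l.natDegree = 1 ∧ multiplicity l s = rho s := by
  obtain ⟨l, h₁, h₂, h₃⟩ := Nat.sSup_mem
    (s := {r : ℕ | ∃ p : F[X], p.Monic ∧ p.natDegree = 1 ∧ r = multiplicity p s})
    ⟨_, X, monic_X, natDegree_X, rfl⟩ (bddAbove_multiplicity_linear hs)
  exact ⟨l, h₁, h₂, h₃.symm⟩

theorem irreducible_of_natDegree_eq_one {l : F[X]} (hd : l.natDegree = 1) : Irreducible l :=
  irreducible_of_degree_eq_one ((degree_eq_iff_natDegree_eq_of_pos one_pos).2 hd)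

theorem exists_monic_linear_ne (l : F[X]) :
    ∃ l' : F[X], l'.Monic ∧ l'.natDegree = 1 ∧ l' ≠ l := by
  by_cases h : X = l
  · refine ⟨X - C 1, monic_X_sub_C 1, natDegree_X_sub_C 1, fun h' => ?_⟩
    simpa using congrArg (eval 0) (h'.trans h.symm)
  · exact ⟨X, monic_X, natDegree_X, h⟩

/-- Exchanging a power of a linear factor for one more copy of `p` does not gain divisors. -/
theorem IsMaximal.rho_add_one_le [Finite F] {m : ℕ} {s p : F[X]} (hs : IsMaximal m s)
    (hp : p.Monic) (hpi : Irreducible p) :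
    rho s + 1 ≤ p.natDegree * (multiplicity p s + 2) := by
  obtain ⟨hsm, hdeg, hmax⟩ := hs
  have hd : 0 < p.natDegree := hpi.natDegree_pos
  rcases lt_or_ge (rho s) p.natDegree with hlt | hge
  · nlinarith
  obtain ⟨l, hl, hld, hlr⟩ := exists_multiplicity_eq_rho hsm.ne_zero
  have hli := irreducible_of_natDegree_eq_one hld
  rcases eq_or_ne p l with rfl | hpl
  · rw [hlr, hld]; omega
  have hp_l := not_dvd_of_monic_irreducible hp hpi hl hli hpl
  have hl_p := not_dvd_of_monic_irreducible hl hli hp hpi hpl.symm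
  obtain ⟨v, hv, hpv, hsv⟩ := exists_eq_pow_multiplicity_mul hp hpi hsm
  obtain ⟨u, hu, hlu, hvu⟩ := exists_eq_pow_multiplicity_mul hl hli hv
  rw [← multiplicity_pow_mul_eq hli hv.ne_zero hp.ne_zero hl_p (multiplicity p s), ← hsv,
    hlr] at hvu
  have hpu : ¬ p ∣ u := fun h => hpv (hvu ▸ h.mul_left _)
  subst hvu
  have hcop (k : ℕ) : ¬ p ∣ l ^ k * u := fun h =>
    (hpi.prime.dvd_or_dvd h).elim (fun h => hp_l (hpi.prime.dvd_of_dvd_pow h)) hpu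
  generalize multiplicity p s = r at *
  generalize rho s = ρ at *
  obtain ⟨e, rfl⟩ := Nat.exists_eq_add_of_le hge
  have key := hmax (p ^ (r + 1) * (l ^ e * u)) ((hp.pow _).mul ((hl.pow _).mul hu)) (by
    rw [← hdeg, hsv]
    simp only [(hp.pow _).natDegree_mul ((hl.pow _).mul hu), (hl.pow _).natDegree_mul hu,
      hp.natDegree_pow, hl.natDegree_pow, hld]
    apply le_of_eq
    ring)
  rw [hsv, numDiv_pow_mul hp hpi (hcop _), numDiv_pow_mul hp hpi (hcop _),
    numDiv_pow_mul hl hli hlu, numDiv_pow_mul hl hli hlu, ← mul_assoc, ← mul_assoc] at key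
  have := Nat.le_of_mul_le_mul_right key (numDiv_pos hu.ne_zero)
  nlinarith

/-- Exchanging a copy of `p` for powers of two distinct linear factors does not gain divisors. -/
theorem IsMaximal.natDegree_mul_multiplicity_le_rho [Finite F] {m : ℕ} {s p : F[X]}
    (hs : IsMaximal m s) (hp : p.Monic) (hpi : Irreducible p) :
    p.natDegree * multiplicity p s ≤ rho s := by
  obtain ⟨hsm, hdeg, hmax⟩ := hs
  have hd : 0 < p.natDegree := hpi.natDegree_pos
  rcases (Nat.succ_le_of_lt hd).eq_or_lt with h1 | hd2
  · simpa [← h1] using multiplicity_le_rho hp h1.symm hsm.ne_zero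
  rcases Nat.eq_zero_or_pos (multiplicity p s) with h0 | hr
  · simp [h0]
  obtain ⟨l, hl, hld, hlr⟩ := exists_multiplicity_eq_rho hsm.ne_zero
  obtain ⟨k, hk, hkd, hkl⟩ := exists_monic_linear_ne l
  have hli := irreducible_of_natDegree_eq_one hld
  have hki := irreducible_of_natDegree_eq_one hkd
  have hkr := multiplicity_le_rho hk hkd hsm.ne_zero
  have hpl : p ≠ l := by rintro rfl; omega
  have hpk : p ≠ k := by rintro rfl; omega
  have hp_l := not_dvd_of_monic_irreducible hp hpi hl hli hpl
  have hl_p := not_dvd_of_monic_irreducible hl hli hp hpi hpl.symm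
  have hp_k := not_dvd_of_monic_irreducible hp hpi hk hki hpk
  have hk_p := not_dvd_of_monic_irreducible hk hki hp hpi hpk.symm
  have hl_k := not_dvd_of_monic_irreducible hl hli hk hki hkl.symm
  have hk_l := not_dvd_of_monic_irreducible hk hki hl hli hkl
  obtain ⟨v, hv, hpv, hsv⟩ := exists_eq_pow_multiplicity_mul hp hpi hsm
  obtain ⟨w, hw, hlw, hvw⟩ := exists_eq_pow_multiplicity_mul hl hli hv
  obtain ⟨u, hu, hku, hwu⟩ := exists_eq_pow_multiplicity_mul hk hki hw
  rw [← multiplicity_pow_mul_eq hki hw.ne_zero hl.ne_zero hk_l (multiplicity l v), ← hvw,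
    ← multiplicity_pow_mul_eq hki hv.ne_zero hp.ne_zero hk_p (multiplicity p s), ← hsv] at hwu
  rw [← multiplicity_pow_mul_eq hli hv.ne_zero hp.ne_zero hl_p (multiplicity p s), ← hsv,
    hlr] at hvw
  have hpw : ¬ p ∣ w := fun h => hpv (hvw ▸ h.mul_left _)
  have hpu : ¬ p ∣ u := fun h => hpw (hwu ▸ h.mul_left _)
  have hlu : ¬ l ∣ u := fun h => hlw (hwu ▸ h.mul_left _)
  subst hvw
  subst hwu
  have hcop (i j : ℕ) : ¬ p ∣ l ^ i * (k ^ j * u) := fun h =>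
    (hpi.prime.dvd_or_dvd h).elim (fun h => hp_l (hpi.prime.dvd_of_dvd_pow h)) fun h =>
      (hpi.prime.dvd_or_dvd h).elim (fun h => hp_k (hpi.prime.dvd_of_dvd_pow h)) hpu
  have hcop' (j : ℕ) : ¬ l ∣ k ^ j * u := fun h =>
    (hli.prime.dvd_or_dvd h).elim (fun h => hl_k (hli.prime.dvd_of_dvd_pow h)) hlu
  generalize multiplicity p s = r at *
  generalize multiplicity k s = σ at *
  generalize rho s = ρ at *
  obtain ⟨r, rfl⟩ := Nat.exists_eq_add_of_lt hr
  obtain ⟨e, he⟩ := Nat.exists_eq_add_of_lt hd2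
  have key := hmax (p ^ r * (l ^ (ρ + (e + 1)) * (k ^ (σ + 1) * u)))
    ((hp.pow _).mul ((hl.pow _).mul ((hk.pow _).mul hu))) (by
    rw [← hdeg, hsv]
    simp only [(hp.pow _).natDegree_mul ((hl.pow _).mul ((hk.pow _).mul hu)),
      (hl.pow _).natDegree_mul ((hk.pow _).mul hu), (hk.pow _).natDegree_mul hu,
      hp.natDegree_pow, hl.natDegree_pow, hk.natDegree_pow, hld, hkd, he]
    apply le_of_eq
    ring)
  rw [hsv, numDiv_pow_mul hp hpi (hcop _ _), numDiv_pow_mul hp hpi (hcop _ _),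
    numDiv_pow_mul hl hli (hcop' _), numDiv_pow_mul hl hli (hcop' _),
    numDiv_pow_mul hk hki hku, numDiv_pow_mul hk hki hku] at key
  simp only [← mul_assoc] at key
  have key' := Nat.le_of_mul_le_mul_right key (numDiv_pos hu.ne_zero)
  rw [he]
  by_contra! hlt
  obtain ⟨t, rfl⟩ := Nat.exists_eq_add_of_le hkr
  have hmul := Nat.mul_le_mul_left (σ + 1) hlt
  have hpos : 0 ≤ r * t + r * e := Nat.zero_le _
  nlinarith

end

/-- Proposition 2: if `s ∈ M_m` is maximal and `ρ = ρ(s)`, then for every monic irreducible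
`p` of degree `d` with `r = mult_p(s)` one has `(ρ+1)/(r+2) ≤ d`, and `d < (ρ+1)/r` when
`r ≥ 1`; equivalently, every monic irreducible factor `p` of `s` has
`mult_p(s) ∈ {⌊ρ/d⌋, ⌊ρ/d⌋ - 1}`. -/
theorem maximal_mult_degree_bounds {F : Type} [Field F] [Fintype F]
    (m : ℕ) (hm : 0 < m) (s : F[X]) (hs : IsMaximal m s) :
    (∀ p : F[X], p.Monic → Irreducible p →
      ((rho s : ℝ) + 1) / ((multiplicity p s : ℝ) + 2) ≤ (p.natDegree : ℝ) ∧
      (1 ≤ multiplicity p s →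
        (p.natDegree : ℝ) < ((rho s : ℝ) + 1) / (multiplicity p s : ℝ))) ∧
    (∀ p : F[X], p.Monic → Irreducible p → p ∣ s →
      multiplicity p s = rho s / p.natDegree ∨
      multiplicity p s = rho s / p.natDegree - 1) := by
  have hmul := fun p (hp : p.Monic) (hpi : Irreducible p) =>
    And.intro (hs.rho_add_one_le hp hpi) (hs.natDegree_mul_multiplicity_le_rho hp hpi)
  refine ⟨fun p hp hpi => ⟨?_, fun hr => ?_⟩, fun p hp hpi _ => ?_⟩
  · rw [div_le_iff₀ (by positivity)]
    exact_mod_cast (hmul p hp hpi).1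
  · rw [lt_div_iff₀ (by exact_mod_cast hr)]
    exact_mod_cast Nat.lt_succ_of_le (hmul p hp hpi).2
  · obtain ⟨h₁, h₂⟩ := hmul p hp hpi
    have hd : 0 < p.natDegree := hpi.natDegree_pos
    have h₃ : multiplicity p s ≤ rho s / p.natDegree :=
      (Nat.le_div_iff_mul_le hd).2 (by rwa [mul_comm])
    have h₄ : rho s / p.natDegree < multiplicity p s + 2 :=
      (Nat.div_lt_iff_lt_mul hd).2 (by rw [mul_comm]; omega)
    omega
end

section
/- There exist absolute constants C₁, C₂ > 0 (independent of q and m) such that for every prime power q, every integer m ≥ q², every maximal s ∈ M_m, and every monic irreducible factor p of s whose degree d satisfies d ≥ C₁·(1 + log_q log_q m), writing r = mult_p(s), one has log₂(1 + 1/(r + 1))·⌊log_q m⌋ − C₂ < d ≤ log₂(1 + 1/r)·⌊log_q m⌋ + C₂. -/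
open Polynomial

open UniqueFactorizationMonoid

/-- The finite set of monic irreducible polynomials of degree `n`. -/
noncomputable def monicIrreducibles (F : Type) [Field F] [Fintype F] (n : ℕ) : Finset F[X] := by
  classical
  exact {p ∈ (normalizedFactors (X ^ Fintype.card F ^ n - X : F[X])).toFinset | p.natDegree = n}

section Divisors

variable {F : Type} [Field F]

lemma prod_normalizedFactors_of_monic [DecidableEq F] {s : F[X]} (hs : s.Monic) :
    (normalizedFactors s).prod = s := by
  rw [prod_normalizedFactors_eq hs.ne_zero, hs.normalize_eq_self]

lemma normalizedFactors_prod_of_monic [DecidableEq F] {M : Multiset F[X]}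
    (hM : ∀ p ∈ M, p.Monic ∧ Irreducible p) : normalizedFactors M.prod = M := by
  rw [normalizedFactors_prod_eq M fun p hp => (hM p hp).2]
  conv_rhs => rw [← Multiset.map_id M]
  exact Multiset.map_congr rfl fun p hp => (hM p hp).1.normalize_eq_self

lemma monic_and_irreducible_of_mem_normalizedFactors [DecidableEq F] {s p : F[X]}
    (hp : p ∈ normalizedFactors s) : p.Monic ∧ Irreducible p := by
  have h := irreducible_of_normalized_factor p hp
  refine ⟨?_, h⟩
  rw [← normalize_normalized_factor p hp]
  exact monic_normalize h.ne_zero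

lemma mem_normalizedFactors_of_monic [DecidableEq F] {s p : F[X]} (hs : s ≠ 0) :
    p ∈ normalizedFactors s ↔ p.Monic ∧ Irreducible p ∧ p ∣ s := by
  refine ⟨fun h => ?_, fun ⟨h₁, h₂, h₃⟩ => ?_⟩
  · obtain ⟨h₁, h₂⟩ := monic_and_irreducible_of_mem_normalizedFactors h
    exact ⟨h₁, h₂, dvd_of_mem_normalizedFactors h⟩
  · exact (mem_normalizedFactors_iff' hs).2 ⟨h₂, h₁.normalize_eq_self, h₃⟩

lemma count_normalizedFactors_of_monic [DecidableEq F] {s p : F[X]} (hs : s ≠ 0)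
    (hp : p.Monic) (hpi : Irreducible p) :
    (normalizedFactors s).count p = multiplicity p s := by
  rw [multiplicity_eq_count_normalizedFactors hpi hs, hp.normalize_eq_self]

lemma numDiv_prod {M : Multiset F[X]} [DecidableEq F]
    (hM : ∀ p ∈ M, p.Monic ∧ Irreducible p) :
    numDiv M.prod = ∏ p ∈ M.toFinset, (M.count p + 1) := by
  have hmon : ∀ t ≤ M, t.prod.Monic := fun t ht => by
    simpa using monic_multiset_prod_of_monic t id
      fun p hp => (hM p (Multiset.mem_of_le ht hp)).1
  rw [← Multiset.card_Iic, numDiv, ← Set.ncard_coe_finset]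
  refine Set.ncard_congr (fun d _ => normalizedFactors d) ?_ ?_ ?_
  · rintro d ⟨hd, hdM⟩
    have := (dvd_iff_normalizedFactors_le_normalizedFactors hd.ne_zero
      (hmon M le_rfl).ne_zero).1 hdM
    rw [normalizedFactors_prod_of_monic hM] at this
    simpa using this
  · rintro a b ⟨ha, -⟩ ⟨hb, -⟩ hab
    rw [← prod_normalizedFactors_of_monic ha, hab, prod_normalizedFactors_of_monic hb]
  · intro t ht
    have ht : t ≤ M := by simpa using ht
    exact ⟨t.prod, ⟨hmon t ht, Multiset.prod_dvd_prod_of_le ht⟩,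
      normalizedFactors_prod_of_monic fun p hp => hM p (Multiset.mem_of_le ht hp)⟩

lemma numDiv_prod_pow {T : Finset F[X]} (hT : ∀ p ∈ T, p.Monic ∧ Irreducible p)
    (g : F[X] → ℕ) : numDiv (∏ p ∈ T, p ^ g p) = ∏ p ∈ T, (g p + 1) := by
  classical
  set M : Multiset F[X] := ∑ p ∈ T, Multiset.replicate (g p) p with hMdef
  have hprod : M.prod = ∏ p ∈ T, p ^ g p := by
    simp [hMdef, Multiset.prod_sum]
  have hcount : ∀ p, M.count p = if p ∈ T then g p else 0 := fun p => by
    simp [hMdef, Multiset.count_sum', Multiset.count_replicate]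
  have hmem : ∀ p ∈ M, p ∈ T := fun p hp => by
    by_contra h
    have := hcount p
    rw [if_neg h, Multiset.count_eq_zero] at this
    exact this hp
  rw [← hprod, numDiv_prod fun p hp => hT p (hmem p hp)]
  rw [Finset.prod_subset (s₂ := T)]
  · exact Finset.prod_congr rfl fun p hp => by rw [hcount, if_pos hp]
  · intro p hp
    exact hmem p (Multiset.mem_toFinset.1 hp)
  · intro p _ hp
    rw [Multiset.count_eq_zero.2 fun h => hp (Multiset.mem_toFinset.2 h), zero_add]

lemma natDegree_prod_pow {T : Finset F[X]} (hT : ∀ p ∈ T, p.Monic ∧ Irreducible p)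
    (g : F[X] → ℕ) : (∏ p ∈ T, p ^ g p).natDegree = ∑ p ∈ T, g p * p.natDegree := by
  rw [natDegree_prod_of_monic _ _ fun p hp => (hT p hp).1.pow _]
  exact Finset.sum_congr rfl fun p hp => natDegree_pow _ _

lemma prod_pow_multiplicity {s : F[X]} (hs : s.Monic) {T : Finset F[X]}
    (hT : ∀ p ∈ T, p.Monic ∧ Irreducible p)
    (hsT : ∀ p : F[X], p.Monic → Irreducible p → p ∣ s → p ∈ T) :
    ∏ p ∈ T, p ^ multiplicity p s = s := by
  classical
  conv_rhs => rw [← prod_normalizedFactors_of_monic hs, Finset.prod_multiset_count]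
  symm
  have : ∀ p ∈ T, (normalizedFactors s).count p = multiplicity p s := fun p hp =>
    count_normalizedFactors_of_monic hs.ne_zero (hT p hp).1 (hT p hp).2
  rw [Finset.prod_subset (s₂ := T)]
  · exact Finset.prod_congr rfl fun p hp => by rw [this p hp]
  · intro p hp
    rw [Multiset.mem_toFinset, mem_normalizedFactors_of_monic hs.ne_zero] at hp
    exact hsT p hp.1 hp.2.1 hp.2.2
  · intro p _ hp
    rw [Multiset.count_eq_zero.2 fun h => hp (Multiset.mem_toFinset.2 h), pow_zero]

lemma numDiv_lt_numDiv_mul_X {t : F[X]} (ht : t.Monic) : numDiv t < numDiv (X * t) := by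
  classical
  set T := insert X (normalizedFactors t).toFinset with hTdef
  have hT : ∀ p ∈ T, p.Monic ∧ Irreducible p := by
    intro p hp
    rw [hTdef, Finset.mem_insert, Multiset.mem_toFinset] at hp
    rcases hp with rfl | hp
    · exact ⟨monic_X, irreducible_X⟩
    · exact monic_and_irreducible_of_mem_normalizedFactors hp
  have hX : X ∈ T := Finset.mem_insert_self _ _
  have ht' : ∏ p ∈ T, p ^ multiplicity p t = t := prod_pow_multiplicity ht hT fun p h₁ h₂ h₃ =>
    Finset.mem_insert_of_mem (Multiset.mem_toFinset.2
      ((mem_normalizedFactors_of_monic ht.ne_zero).2 ⟨h₁, h₂, h₃⟩))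
  have hXt : ∏ p ∈ T, p ^ (multiplicity p t + if p = X then 1 else 0) = X * t := by
    simp_rw [pow_add, Finset.prod_mul_distrib, ht', pow_ite, pow_one, pow_zero]
    rw [Finset.prod_ite_eq_of_mem' T X _ hX, mul_comm]
  rw [← hXt]
  conv_lhs => rw [← ht']
  rw [numDiv_prod_pow hT, numDiv_prod_pow hT]
  refine Finset.prod_lt_prod (fun p _ => by positivity) (fun p _ => by omega) ⟨X, hX, ?_⟩
  simp

end Divisors

namespace IsMaximal

variable {F : Type} [Field F] {m : ℕ} {s : F[X]}

lemma numDiv_lt (hs : IsMaximal m s) {t : F[X]} (ht : t.Monic) (htm : t.natDegree < m) :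
    numDiv t < numDiv s := by
  refine (numDiv_lt_numDiv_mul_X ht).trans_le (hs.2.2 _ (monic_X.mul ht) ?_)
  rw [monic_X.natDegree_mul ht, natDegree_X]
  omega

lemma exchange_aux (hs : IsMaximal m s) {T : Finset F[X]}
    (hT : ∀ p ∈ T, p.Monic ∧ Irreducible p) (g : F[X] → ℕ) :
    (∑ p ∈ T, g p * p.natDegree ≤ ∑ p ∈ T, multiplicity p s * p.natDegree →
      ∏ p ∈ T, (g p + 1) ≤ ∏ p ∈ T, (multiplicity p s + 1)) ∧
    (∑ p ∈ T, g p * p.natDegree < ∑ p ∈ T, multiplicity p s * p.natDegree →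
      ∏ p ∈ T, (g p + 1) < ∏ p ∈ T, (multiplicity p s + 1)) := by
  classical
  set S := T ∪ (normalizedFactors s).toFinset with hSdef
  have hS : ∀ p ∈ S, p.Monic ∧ Irreducible p := by
    intro p hp
    rw [hSdef, Finset.mem_union, Multiset.mem_toFinset] at hp
    exact hp.elim (hT p) monic_and_irreducible_of_mem_normalizedFactors
  have hTS : T ⊆ S := Finset.subset_union_left
  have hsS : ∏ p ∈ S, p ^ multiplicity p s = s := prod_pow_multiplicity hs.1 hS
    fun p h₁ h₂ h₃ => Finset.mem_union_right _ (Multiset.mem_toFinset.2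
      ((mem_normalizedFactors_of_monic hs.1.ne_zero).2 ⟨h₁, h₂, h₃⟩))
  set g' : F[X] → ℕ := fun p => if p ∈ T then g p else multiplicity p s with hg'
  set t := ∏ p ∈ S, p ^ g' p with ht
  have htmon : t.Monic := monic_prod_of_monic _ _ fun p hp => (hS p hp).1.pow _
  have hin : ∀ p ∈ T, g' p = g p := fun p hp => if_pos hp
  have hout : ∀ p ∈ S \ T, g' p = multiplicity p s := fun p hp =>
    if_neg (Finset.mem_sdiff.1 hp).2
  have hdt : t.natDegree = ∑ p ∈ S \ T, multiplicity p s * p.natDegree +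
      ∑ p ∈ T, g p * p.natDegree := by
    rw [ht, natDegree_prod_pow hS, ← Finset.sum_sdiff hTS]
    congr 1
    · exact Finset.sum_congr rfl fun p hp => by rw [hout p hp]
    · exact Finset.sum_congr rfl fun p hp => by rw [hin p hp]
  have hnt : numDiv t = (∏ p ∈ S \ T, (multiplicity p s + 1)) * ∏ p ∈ T, (g p + 1) := by
    rw [ht, numDiv_prod_pow hS, ← Finset.prod_sdiff hTS]
    congr 1
    · exact Finset.prod_congr rfl fun p hp => by rw [hout p hp]
    · exact Finset.prod_congr rfl fun p hp => by rw [hin p hp]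
  have hds : m = ∑ p ∈ S \ T, multiplicity p s * p.natDegree +
      ∑ p ∈ T, multiplicity p s * p.natDegree := by
    rw [Finset.sum_sdiff hTS, ← natDegree_prod_pow hS, hsS, hs.2.1]
  have hns : numDiv s = (∏ p ∈ S \ T, (multiplicity p s + 1)) *
      ∏ p ∈ T, (multiplicity p s + 1) := by
    rw [Finset.prod_sdiff hTS, ← numDiv_prod_pow hS, hsS]
  refine ⟨fun h => ?_, fun h => ?_⟩
  · have := hs.2.2 t htmon (by omega)
    rw [hnt, hns] at this
    exact Nat.le_of_mul_le_mul_left this (Finset.prod_pos fun p _ => by positivity)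
  · have := hs.numDiv_lt htmon (by omega)
    rw [hnt, hns] at this
    exact lt_of_mul_lt_mul_left' this

lemma exchange (hs : IsMaximal m s) {T : Finset F[X]}
    (hT : ∀ p ∈ T, p.Monic ∧ Irreducible p) (g : F[X] → ℕ)
    (h : ∑ p ∈ T, g p * p.natDegree ≤ ∑ p ∈ T, multiplicity p s * p.natDegree) :
    ∏ p ∈ T, (g p + 1) ≤ ∏ p ∈ T, (multiplicity p s + 1) :=
  (hs.exchange_aux hT g).1 h

lemma exchange_strict (hs : IsMaximal m s) {T : Finset F[X]}
    (hT : ∀ p ∈ T, p.Monic ∧ Irreducible p) (g : F[X] → ℕ)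
    (h : ∑ p ∈ T, g p * p.natDegree < ∑ p ∈ T, multiplicity p s * p.natDegree) :
    ∏ p ∈ T, (g p + 1) < ∏ p ∈ T, (multiplicity p s + 1) :=
  (hs.exchange_aux hT g).2 h

end IsMaximal

section Counting

variable {F : Type} [Field F] [Fintype F]

lemma X_pow_card_pow_sub_X_ne_zero {n : ℕ} (hn : n ≠ 0) :
    (X ^ Fintype.card F ^ n - X : F[X]) ≠ 0 :=
  FiniteField.X_pow_card_pow_sub_X_ne_zero F hn Fintype.one_lt_card

lemma mem_normalizedFactors_X_pow_card_pow_sub_X [DecidableEq F] {n : ℕ} (hn : n ≠ 0)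
    {p : F[X]} :
    p ∈ normalizedFactors (X ^ Fintype.card F ^ n - X : F[X]) ↔
      p.Monic ∧ Irreducible p ∧ p.natDegree ∣ n := by
  rw [mem_normalizedFactors_of_monic (X_pow_card_pow_sub_X_ne_zero hn)]
  refine and_congr_right fun _ => and_congr_right fun h => ?_
  rw [h.natDegree_dvd_iff_dvd_X_pow_card_pow_sub_X, Nat.card_eq_fintype_card]

lemma mem_monicIrreducibles {n : ℕ} {p : F[X]} :
    p ∈ monicIrreducibles F n ↔ p.Monic ∧ Irreducible p ∧ p.natDegree = n := by
  classical
  rcases eq_or_ne n 0 with rfl | hn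
  · simp only [monicIrreducibles, pow_zero, pow_one, sub_self, normalizedFactors_zero]
    simp only [Multiset.toFinset_zero, Finset.filter_empty, Finset.notMem_empty, false_iff]
    rintro ⟨-, h, h0⟩
    exact h.natDegree_pos.ne' h0
  · have h : p ∈ monicIrreducibles F n ↔
        p ∈ normalizedFactors (X ^ Fintype.card F ^ n - X : F[X]) ∧ p.natDegree = n := by
      rw [monicIrreducibles, Finset.mem_filter, Multiset.mem_toFinset]
    rw [h, mem_normalizedFactors_X_pow_card_pow_sub_X hn]
    constructor
    · rintro ⟨⟨h₁, h₂, -⟩, h₃⟩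
      exact ⟨h₁, h₂, h₃⟩
    · rintro ⟨h₁, h₂, h₃⟩
      exact ⟨⟨h₁, h₂, h₃.dvd⟩, h₃⟩

lemma X_pow_card_pow_sub_X_separable {n : ℕ} (hn : n ≠ 0) :
    (X ^ Fintype.card F ^ n - X : F[X]).Separable := by
  obtain ⟨c, hc⟩ := CharP.exists F
  refine galois_poly_separable c _ (dvd_pow ?_ hn)
  rw [← CharP.cast_eq_zero_iff F c, Nat.cast_card_eq_zero]

lemma prod_toFinset_normalizedFactors_X_pow_card_pow_sub_X [DecidableEq F] {n : ℕ} (hn : n ≠ 0) :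
    ∏ p ∈ (normalizedFactors (X ^ Fintype.card F ^ n - X : F[X])).toFinset, p =
      X ^ Fintype.card F ^ n - X := by
  have hnodup := (squarefree_iff_nodup_normalizedFactors (X_pow_card_pow_sub_X_ne_zero hn)).1
    (X_pow_card_pow_sub_X_separable (F := F) hn).squarefree
  have hmon : (X ^ Fintype.card F ^ n - X : F[X]).Monic := by
    refine monic_X_pow_sub ?_
    rw [degree_X]
    exact_mod_cast Nat.one_lt_pow hn Fintype.one_lt_card
  conv_rhs => rw [← prod_normalizedFactors_of_monic hmon]
  rw [Finset.prod, Multiset.toFinset_val, hnodup.dedup, Multiset.map_id']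

lemma sum_divisors_mul_card_monicIrreducibles {n : ℕ} (hn : n ≠ 0) :
    ∑ e ∈ n.divisors, e * (monicIrreducibles F e).card = Fintype.card F ^ n := by
  classical
  have hdeg := congrArg natDegree (prod_toFinset_normalizedFactors_X_pow_card_pow_sub_X (F := F) hn)
  rw [FiniteField.X_pow_card_pow_sub_X_natDegree_eq F hn Fintype.one_lt_card,
    natDegree_prod_of_monic _ _ fun p hp =>
      (monic_and_irreducible_of_mem_normalizedFactors (Multiset.mem_toFinset.1 hp)).1,
    ← Finset.sum_fiberwise_of_maps_to (t := n.divisors) (g := natDegree)] at hdeg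
  · rw [← hdeg]
    refine Finset.sum_congr rfl fun e he => ?_
    have : {p ∈ (normalizedFactors (X ^ Fintype.card F ^ n - X : F[X])).toFinset |
        p.natDegree = e} = monicIrreducibles F e := by
      ext p
      rw [Finset.mem_filter, Multiset.mem_toFinset,
        mem_normalizedFactors_X_pow_card_pow_sub_X hn, mem_monicIrreducibles]
      constructor
      · rintro ⟨⟨h₁, h₂, -⟩, h₃⟩
        exact ⟨h₁, h₂, h₃⟩
      · rintro ⟨h₁, h₂, h₃⟩
        exact ⟨⟨h₁, h₂, h₃ ▸ Nat.dvd_of_mem_divisors he⟩, h₃⟩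
    rw [this, Finset.sum_congr rfl fun p hp => (mem_monicIrreducibles.1 hp).2.2,
      Finset.sum_const, smul_eq_mul, mul_comm]
  · intro p hp
    rw [Multiset.mem_toFinset, mem_normalizedFactors_X_pow_card_pow_sub_X hn] at hp
    exact Nat.mem_divisors.2 ⟨hp.2.2, hn⟩

lemma mul_card_monicIrreducibles_le (n : ℕ) :
    n * (monicIrreducibles F n).card ≤ Fintype.card F ^ n := by
  rcases eq_or_ne n 0 with rfl | hn
  · simp
  · rw [← sum_divisors_mul_card_monicIrreducibles hn]
    exact Finset.single_le_sum (f := fun e => e * (monicIrreducibles F e).card)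
      (fun _ _ => Nat.zero_le _) (Nat.mem_divisors_self n hn)

lemma card_pow_le_two_mul_card_monicIrreducibles {n : ℕ} (hn : 4 ≤ n) :
    Fintype.card F ^ n ≤ 2 * (n * (monicIrreducibles F n).card) := by
  have hq : 2 ≤ Fintype.card F := Fintype.one_lt_card
  have hsum := sum_divisors_mul_card_monicIrreducibles (F := F) (n := n) (by omega)
  rw [← Nat.insert_self_properDivisors (by omega), Finset.sum_insert (by simp)] at hsum
  have hle : ∑ e ∈ n.properDivisors, e * (monicIrreducibles F e).card ≤
      ∑ e ∈ Finset.range (n / 2 + 1), Fintype.card F ^ e := by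
    refine (Finset.sum_le_sum fun e _ => mul_card_monicIrreducibles_le e).trans ?_
    refine Finset.sum_le_sum_of_subset fun e he => ?_
    obtain ⟨⟨k, rfl⟩, hlt⟩ := Nat.mem_properDivisors.1 he
    have hk : 2 ≤ k := by
      rcases k with _ | _ | k <;> simp_all
    rw [Finset.mem_range, Nat.lt_succ_iff, Nat.le_div_iff_mul_le two_pos]
    gcongr
  have hgeom : ∑ e ∈ Finset.range (n / 2 + 1), Fintype.card F ^ e < 2 * Fintype.card F ^ (n / 2) := by
    rw [Finset.sum_range_succ, two_mul]
    gcongr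
    exact Nat.geomSum_lt hq fun e he => Finset.mem_range.1 he
  have h4 : 4 * Fintype.card F ^ (n / 2) ≤ Fintype.card F ^ n := by
    have h₁ : 2 ^ 2 ≤ Fintype.card F ^ (n / 2) := (Nat.pow_le_pow_left hq 2).trans
      (Nat.pow_le_pow_right (by omega) (by omega))
    calc 4 * Fintype.card F ^ (n / 2) ≤ Fintype.card F ^ (n / 2) * Fintype.card F ^ (n / 2) := by gcongr; exact h₁
      _ = Fintype.card F ^ (n / 2 + n / 2) := (pow_add _ _ _).symm
      _ ≤ Fintype.card F ^ n := Nat.pow_le_pow_right (by omega) (by omega)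
  omega

lemma le_card_monicIrreducibles {n k : ℕ} (hn : 4 ≤ n) (h : 2 * n * k ≤ Fintype.card F ^ n) :
    k ≤ (monicIrreducibles F n).card := by
  have := h.trans (card_pow_le_two_mul_card_monicIrreducibles hn)
  rw [mul_assoc] at this
  exact Nat.le_of_mul_le_mul_left (Nat.le_of_mul_le_mul_left this two_pos) (by omega)

lemma mul_sum_card_monicIrreducibles_le {E : ℕ} (hE : 1 ≤ E) :
    E * ∑ e ∈ Finset.Icc 1 E, (monicIrreducibles F e).card ≤ 4 * Fintype.card F ^ E := by
  have hq : 2 ≤ Fintype.card F := Fintype.one_lt_card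
  induction E, hE using Nat.le_induction with
  | base =>
    have := mul_card_monicIrreducibles_le (F := F) 1
    simp only [Finset.Icc_self, Finset.sum_singleton]
    omega
  | succ E hE ih =>
    have := mul_card_monicIrreducibles_le (F := F) (E + 1)
    rw [Finset.sum_Icc_succ_top (by omega), mul_add]
    rcases hE.eq_or_lt with rfl | hE
    · have := mul_card_monicIrreducibles_le (F := F) 1
      simp only [Finset.Icc_self, Finset.sum_singleton]
      norm_num at *
      nlinarith
    · set P := ∑ e ∈ Finset.Icc 1 E, (monicIrreducibles F e).card
      have h₁ : 2 * ((E + 1) * P) ≤ 3 * (E * P) := by nlinarith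
      have h₂ : 2 * Fintype.card F ^ E ≤ Fintype.card F ^ (E + 1) := by
        rw [pow_succ']
        gcongr
      omega

/-- If every monic irreducible of degree dividing `n` divides `s ≠ 0`, then `deg s ≥ q ^ n`. -/
lemma exists_not_dvd_of_natDegree_lt {s : F[X]} (hs : s ≠ 0) {n : ℕ} (hn : n ≠ 0)
    (h : s.natDegree < Fintype.card F ^ n) :
    ∃ t : F[X], t.Monic ∧ Irreducible t ∧ t.natDegree ≤ n ∧ ¬ t ∣ s := by
  classical
  by_contra! hcon
  have hdvd : (X ^ Fintype.card F ^ n - X : F[X]) ∣ s := by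
    rw [← prod_toFinset_normalizedFactors_X_pow_card_pow_sub_X hn]
    have hmem : ∀ p ∈ (normalizedFactors (X ^ Fintype.card F ^ n - X : F[X])).toFinset,
        p ∈ (normalizedFactors s).toFinset := fun p hp => by
      rw [Multiset.mem_toFinset, mem_normalizedFactors_X_pow_card_pow_sub_X hn] at hp
      rw [Multiset.mem_toFinset, mem_normalizedFactors_of_monic hs]
      exact ⟨hp.1, hp.2.1, hcon p hp.1 hp.2.1 (Nat.le_of_dvd (by omega) hp.2.2)⟩
    refine (Finset.prod_dvd_prod_of_subset _ _ _ hmem).trans ?_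
    rw [Finset.prod, Multiset.toFinset_val, Multiset.map_id']
    exact (Multiset.prod_dvd_prod_of_le (Multiset.dedup_le _)).trans
      (prod_normalizedFactors hs).dvd
  have := natDegree_le_of_dvd hdvd hs
  rw [FiniteField.X_pow_card_pow_sub_X_natDegree_eq F hn Fintype.one_lt_card] at this
  omega

end Counting

namespace IsMaximal

variable {F : Type} [Field F] {m : ℕ} {s : F[X]}

lemma multiplicity_le_of_natDegree_lt (hs : IsMaximal m s) {p p' : F[X]}
    (hp : p.Monic) (hpi : Irreducible p) (hp' : p'.Monic) (hpi' : Irreducible p')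
    (h : p'.natDegree < p.natDegree) : multiplicity p s ≤ multiplicity p' s := by
  classical
  by_contra! hlt
  have hne : p ≠ p' := by
    rintro rfl
    exact h.false
  have key := hs.exchange_strict (T := {p, p'}) (by simp [hp, hpi, hp', hpi'])
    (fun x => if x = p then multiplicity p s - 1 else multiplicity p' s + 1)
  simp only [Finset.sum_pair hne, Finset.prod_pair hne, if_neg hne.symm, if_true] at key
  obtain ⟨k, hk⟩ : ∃ k, multiplicity p s = k + 1 := ⟨multiplicity p s - 1, by omega⟩
  rw [hk, Nat.add_sub_cancel] at key
  have := key (by nlinarith)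
  nlinarith

lemma prod_exchange (hs : IsMaximal m s) {A B : Finset F[X]} (hAB : Disjoint A B)
    (hA : ∀ p ∈ A, p.Monic ∧ Irreducible p) (hB : ∀ p ∈ B, p.Monic ∧ Irreducible p)
    (hAs : ∀ p ∈ A, 1 ≤ multiplicity p s)
    (h : ∑ p ∈ B, p.natDegree ≤ ∑ p ∈ A, p.natDegree) :
    (∏ p ∈ A, multiplicity p s) * ∏ p ∈ B, (multiplicity p s + 2) ≤
      (∏ p ∈ A, (multiplicity p s + 1)) * ∏ p ∈ B, (multiplicity p s + 1) := by
  classical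
  set g : F[X] → ℕ := fun p => if p ∈ A then multiplicity p s - 1 else multiplicity p s + 1
  have hgA : ∀ p ∈ A, g p + 1 = multiplicity p s := fun p hp => by
    have := hAs p hp
    simp only [g, if_pos hp]
    omega
  have hgB : ∀ p ∈ B, g p = multiplicity p s + 1 := fun p hp =>
    if_neg (Finset.disjoint_right.1 hAB hp)
  have key := hs.exchange (T := A ∪ B)
    (fun p hp => (Finset.mem_union.1 hp).elim (hA p) (hB p)) g
  rw [Finset.sum_union hAB, Finset.sum_union hAB, Finset.prod_union hAB, Finset.prod_union hAB,
    Finset.prod_congr rfl hgA,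
    Finset.prod_congr rfl fun p hp => congrArg (· + 1) (hgB p hp)] at key
  refine key ?_
  have h₁ : ∑ p ∈ A, multiplicity p s * p.natDegree =
      ∑ p ∈ A, g p * p.natDegree + ∑ p ∈ A, p.natDegree := by
    rw [← Finset.sum_add_distrib]
    exact Finset.sum_congr rfl fun p hp => by rw [← hgA p hp, add_one_mul]
  have h₂ : ∑ p ∈ B, g p * p.natDegree =
      ∑ p ∈ B, multiplicity p s * p.natDegree + ∑ p ∈ B, p.natDegree := by
    rw [← Finset.sum_add_distrib]
    exact Finset.sum_congr rfl fun p hp => by rw [hgB p hp, add_one_mul]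
  omega

lemma multiplicity_mul_natDegree_le (hs : IsMaximal m s) {p t : F[X]}
    (hp : p.Monic) (hpi : Irreducible p) (ht : t.Monic) (hti : Irreducible t) (hts : ¬ t ∣ s)
    (h : p.natDegree < t.natDegree) :
    multiplicity p s * p.natDegree ≤ 4 * t.natDegree := by
  classical
  have hne : p ≠ t := by
    rintro rfl
    exact h.false
  have hpos := hpi.natDegree_pos
  set r := multiplicity p s with hr
  set e := p.natDegree
  set n := t.natDegree
  obtain ⟨k, hk₁, hk₂⟩ : ∃ k, n ≤ k * e ∧ k * e ≤ n + e := by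
    refine ⟨n / e + 1, ?_, ?_⟩
    · rw [mul_comm]
      exact (Nat.lt_mul_div_succ n hpos).le
    · rw [add_one_mul]
      exact Nat.add_le_add_right (Nat.div_mul_le_self n e) e
  rcases lt_or_ge r k with hrk | hrk
  · nlinarith
  · obtain ⟨l, hl⟩ := Nat.exists_eq_add_of_le hrk
    have key := hs.exchange (T := {p, t}) (by simp [hp, hpi, ht, hti])
      (fun x => if x = p then l else 1)
    simp only [Finset.sum_pair hne, Finset.prod_pair hne, if_neg hne.symm, if_true,
      multiplicity_eq_zero.2 hts] at key
    rw [← hr, hl] at key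
    have := key (by nlinarith)
    rw [hl]
    nlinarith

variable [Fintype F]

lemma logb_exchange (hs : IsMaximal m s) {a b i j : ℕ} (hab : a ≠ b)
    (ha : b ≤ (monicIrreducibles F a).card) (hb : a ≤ (monicIrreducibles F b).card)
    (hi : 1 ≤ i) (hA : ∀ p ∈ monicIrreducibles F a, i ≤ multiplicity p s)
    (hB : ∀ p ∈ monicIrreducibles F b, multiplicity p s ≤ j) :
    a * Real.logb 2 (1 + 1 / (j + 1)) ≤ b * Real.logb 2 (1 + 1 / i) := by
  obtain ⟨A, hAa, hAcard⟩ := Finset.exists_subset_card_eq ha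
  obtain ⟨B, hBb, hBcard⟩ := Finset.exists_subset_card_eq hb
  have hi' : (1 : ℝ) ≤ i := by exact_mod_cast hi
  have hAI := fun (p : F[X]) (hp : p ∈ A) => mem_monicIrreducibles.1 (hAa hp)
  have hBI := fun (p : F[X]) (hp : p ∈ B) => mem_monicIrreducibles.1 (hBb hp)
  have hmA : ∀ p ∈ A, (i : ℝ) ≤ multiplicity p s := fun p hp => by
    exact_mod_cast hA p (hAa hp)
  have hmB : ∀ p ∈ B, (multiplicity p s : ℝ) ≤ j := fun p hp => by
    exact_mod_cast hB p (hBb hp)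
  have key := hs.prod_exchange (A := A) (B := B)
    (Finset.disjoint_left.2 fun p hp hp' => hab ((hAI p hp).2.2.symm.trans (hBI p hp').2.2))
    (fun p hp => ⟨(hAI p hp).1, (hAI p hp).2.1⟩) (fun p hp => ⟨(hBI p hp).1, (hBI p hp).2.1⟩)
    (fun p hp => hi.trans (hA p (hAa hp))) (by
      rw [Finset.sum_congr rfl fun p hp => (hAI p hp).2.2,
        Finset.sum_congr rfl fun p hp => (hBI p hp).2.2, Finset.sum_const, Finset.sum_const,
        hAcard, hBcard, smul_eq_mul, smul_eq_mul, mul_comm])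
  have key' : (∏ p ∈ A, (multiplicity p s : ℝ)) * ∏ p ∈ B, ((multiplicity p s : ℝ) + 2) ≤
      (∏ p ∈ A, ((multiplicity p s : ℝ) + 1)) * ∏ p ∈ B, ((multiplicity p s : ℝ) + 1) := by
    exact_mod_cast key
  have hAle : ∏ p ∈ A, ((multiplicity p s : ℝ) + 1) ≤
      (1 + 1 / (i : ℝ)) ^ b * ∏ p ∈ A, (multiplicity p s : ℝ) := by
    rw [← hAcard, ← Finset.prod_const, ← Finset.prod_mul_distrib]
    refine Finset.prod_le_prod (fun p _ => by positivity) fun p hp => ?_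
    have := hmA p hp
    have : (1 : ℝ) ≤ 1 / i * multiplicity p s := by
      rw [one_div_mul_eq_div, one_le_div (by linarith)]
      exact this
    linarith
  have hBle : (1 + 1 / ((j : ℝ) + 1)) ^ a * ∏ p ∈ B, ((multiplicity p s : ℝ) + 1) ≤
      ∏ p ∈ B, ((multiplicity p s : ℝ) + 2) := by
    rw [← hBcard, ← Finset.prod_const, ← Finset.prod_mul_distrib]
    refine Finset.prod_le_prod (fun p _ => by positivity) fun p hp => ?_
    have := hmB p hp
    have : 1 / ((j : ℝ) + 1) * (multiplicity p s + 1) ≤ 1 := by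
      rw [one_div_mul_eq_div, div_le_one (by positivity)]
      linarith
    linarith
  have hApos : 0 < ∏ p ∈ A, (multiplicity p s : ℝ) :=
    Finset.prod_pos fun p hp => by linarith [hmA p hp]
  have hBpos : 0 < ∏ p ∈ B, ((multiplicity p s : ℝ) + 1) :=
    Finset.prod_pos fun p _ => by positivity
  have hpow : (1 + 1 / ((j : ℝ) + 1)) ^ a ≤ (1 + 1 / (i : ℝ)) ^ b := by
    refine le_of_mul_le_mul_right ?_ (mul_pos hApos hBpos)
    calc (1 + 1 / ((j : ℝ) + 1)) ^ a * ((∏ p ∈ A, (multiplicity p s : ℝ)) *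
          ∏ p ∈ B, ((multiplicity p s : ℝ) + 1))
        = (∏ p ∈ A, (multiplicity p s : ℝ)) *
          ((1 + 1 / ((j : ℝ) + 1)) ^ a * ∏ p ∈ B, ((multiplicity p s : ℝ) + 1)) := by ring
      _ ≤ (∏ p ∈ A, (multiplicity p s : ℝ)) * ∏ p ∈ B, ((multiplicity p s : ℝ) + 2) := by gcongr
      _ ≤ _ := key'
      _ ≤ (1 + 1 / (i : ℝ)) ^ b * (∏ p ∈ A, (multiplicity p s : ℝ)) *
          ∏ p ∈ B, ((multiplicity p s : ℝ) + 1) := by gcongr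
      _ = _ := by ring
  have := Real.logb_le_logb_of_le one_lt_two (by positivity) hpow
  rwa [Real.logb_pow, Real.logb_pow] at this

lemma multiplicity_eq_zero_of_lt_natDegree (hs : IsMaximal m s) {n : ℕ} (hn : n ≠ 0)
    (hm : m < Fintype.card F ^ n) {p : F[X]} (hp : p.Monic) (hpi : Irreducible p)
    (h : n < p.natDegree) : multiplicity p s = 0 := by
  obtain ⟨t, ht, hti, htn, hts⟩ := exists_not_dvd_of_natDegree_lt hs.1.ne_zero hn
    (by rwa [hs.2.1])
  have := hs.multiplicity_le_of_natDegree_lt hp hpi ht hti (by omega)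
  rwa [multiplicity_eq_zero.2 hts, Nat.le_zero] at this

lemma natDegree_le_of_dvd (hs : IsMaximal m s) {n : ℕ} (hn : n ≠ 0)
    (hm : m < Fintype.card F ^ n) {p : F[X]} (hp : p.Monic) (hpi : Irreducible p)
    (hps : p ∣ s) : p.natDegree ≤ n := by
  by_contra! h
  have h₁ := multiplicity_pos_of_dvd hps
  have h₂ := hs.multiplicity_eq_zero_of_lt_natDegree hn hm hp hpi h
  omega

/-- A maximal polynomial has an irreducible factor whose degree is within `8` of `log_q m`. -/
lemma exists_irreducible_dvd_lt_natDegree (hs : IsMaximal m s) {E : ℕ} (hE : 1 ≤ E)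
    (hm : Fintype.card F ^ (E + 8) ≤ m) {t : F[X]} (ht : t.Monic) (hti : Irreducible t)
    (hts : ¬ t ∣ s) (htE : t.natDegree = E + 10) :
    ∃ p : F[X], p.Monic ∧ Irreducible p ∧ p ∣ s ∧ E < p.natDegree := by
  classical
  by_contra! hcon
  have hq : 2 ≤ Fintype.card F := Fintype.one_lt_card
  set T := (normalizedFactors s).toFinset with hTdef
  have hT : ∀ p ∈ T, p.Monic ∧ Irreducible p ∧ p ∣ s := fun p hp => by
    rwa [hTdef, Multiset.mem_toFinset, mem_normalizedFactors_of_monic hs.1.ne_zero] at hp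
  have hT' : ∀ p ∈ T, p.Monic ∧ Irreducible p := fun p hp => ⟨(hT p hp).1, (hT p hp).2.1⟩
  have hdeg : ∑ p ∈ T, multiplicity p s * p.natDegree = m := by
    rw [← natDegree_prod_pow hT', prod_pow_multiplicity hs.1 hT', hs.2.1]
    intro p h₁ h₂ h₃
    rw [hTdef, Multiset.mem_toFinset, mem_normalizedFactors_of_monic hs.1.ne_zero]
    exact ⟨h₁, h₂, h₃⟩
  have hm_le : m ≤ T.card * (4 * (E + 10)) := by
    rw [← hdeg, ← smul_eq_mul]
    refine Finset.sum_le_card_nsmul _ _ _ fun p hp => ?_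
    obtain ⟨h₁, h₂, h₃⟩ := hT p hp
    have := hcon p h₁ h₂ h₃
    rw [← htE]
    exact hs.multiplicity_mul_natDegree_le h₁ h₂ ht hti hts (by omega)
  have hcard : T.card ≤ ∑ e ∈ Finset.Icc 1 E, (monicIrreducibles F e).card := by
    refine (Finset.card_le_card fun p hp => ?_).trans Finset.card_biUnion_le
    obtain ⟨h₁, h₂, h₃⟩ := hT p hp
    exact Finset.mem_biUnion.2 ⟨p.natDegree,
      Finset.mem_Icc.2 ⟨h₂.natDegree_pos, hcon p h₁ h₂ h₃⟩, mem_monicIrreducibles.2 ⟨h₁, h₂, rfl⟩⟩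
  have hsum := mul_sum_card_monicIrreducibles_le (F := F) hE
  have h256 : 2 ^ 8 * Fintype.card F ^ E ≤ m := by
    refine le_trans ?_ hm
    rw [pow_add, mul_comm]
    gcongr
  have hpos : 0 < Fintype.card F ^ E := by positivity
  have h₁ : E * m ≤ 16 * (E + 10) * Fintype.card F ^ E := by
    calc E * m ≤ E * ((∑ e ∈ Finset.Icc 1 E, (monicIrreducibles F e).card) * (4 * (E + 10))) := by
          gcongr
          exact hm_le.trans (by gcongr)
      _ = (E * ∑ e ∈ Finset.Icc 1 E, (monicIrreducibles F e).card) * (4 * (E + 10)) := by ring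
      _ ≤ (4 * Fintype.card F ^ E) * (4 * (E + 10)) := by gcongr
      _ = _ := by ring
  have h₂ : E * (2 ^ 8 * Fintype.card F ^ E) ≤ E * m := by gcongr
  nlinarith

end IsMaximal

section Arithmetic

lemma two_mul_mul_le_two_pow {N : ℕ} (hN : 2 ≤ N) : 2 * (N + 2) * N ≤ 2 ^ (N + 2) := by
  induction N, hN using Nat.le_induction with
  | base => norm_num
  | succ N hN ih =>
    rw [show N + 1 + 2 = N + 2 + 1 by omega, pow_succ]
    nlinarith

lemma two_mul_sq_le_two_pow {E : ℕ} (hE : 7 ≤ E) : 2 * E * E ≤ 2 ^ E := by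
  induction E, hE using Nat.le_induction with
  | base => norm_num
  | succ E hE ih =>
    rw [pow_succ]
    nlinarith

/-- The degree threshold `5 (1 + log_q log_q m)`, in exponential form. -/
lemma pow_le_pow_of_threshold {q m d : ℕ} (hq : 2 ≤ q) (hm : q ^ 2 ≤ m)
    (hd : 5 * (1 + Real.logb q (Real.logb q m)) ≤ (d : ℝ)) :
    (q * Nat.log q m) ^ 5 ≤ q ^ d := by
  have hq1 : (1 : ℝ) < q := by exact_mod_cast hq
  have hN : 2 ≤ Nat.log q m := Nat.le_log_of_pow_le (by omega) hm
  have hNL : (Nat.log q m : ℝ) ≤ Real.logb q m := by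
    rw [← Real.natFloor_logb_natCast]
    refine Nat.floor_le (Real.logb_nonneg hq1 ?_)
    exact_mod_cast (Nat.one_le_pow _ _ (by omega)).trans hm
  have hNpos : (0 : ℝ) < Nat.log q m := by
    exact_mod_cast (by omega : 0 < Nat.log q m)
  have hlog : Real.logb q (((q : ℝ) * Nat.log q m) ^ 5) ≤ d := by
    rw [Real.logb_pow, Real.logb_mul (by positivity) hNpos.ne', Real.logb_self_eq_one hq1]
    refine le_trans ?_ hd
    push_cast
    gcongr
  rw [Real.logb_le_iff_le_rpow hq1 (by positivity), Real.rpow_natCast] at hlog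
  exact_mod_cast hlog

lemma two_mul_mul_le_pow_of_pow_le {q N d e : ℕ} (hq : 2 ≤ q) (hN : 2 ≤ N)
    (h : (q * N) ^ 5 ≤ q ^ (d + 1)) (he : e ≤ N) : 2 * e * (N + 2) ≤ q ^ d := by
  have h₁ : q ^ 4 * N ^ 5 ≤ q ^ d := by
    have hq0 : 0 < q := by omega
    refine le_of_mul_le_mul_left ?_ hq0
    calc q * (q ^ 4 * N ^ 5) = (q * N) ^ 5 := by ring
      _ ≤ q ^ (d + 1) := h
      _ = q * q ^ d := pow_succ' q d
  have h₂ : 2 ^ 4 ≤ q ^ 4 := Nat.pow_le_pow_left hq 4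
  have h₃ : N ^ 2 ≤ N ^ 5 := Nat.pow_le_pow_right (by omega) (by omega)
  calc 2 * e * (N + 2) ≤ 2 * N * (N + N) := by gcongr
    _ ≤ 2 ^ 4 * N ^ 2 := by nlinarith
    _ ≤ q ^ 4 * N ^ 5 := by gcongr
    _ ≤ q ^ d := h₁

lemma logb_two_one_add_mem_Icc {x : ℝ} (hx : 0 ≤ x) :
    Real.logb 2 (1 + 1 / (x + 1)) ∈ Set.Icc 0 1 := by
  have h : 1 / (x + 1) ≤ 1 := by
    rw [div_le_one (by positivity)]
    linarith
  have h' : 0 ≤ 1 / (x + 1) := by positivity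
  refine ⟨Real.logb_nonneg one_lt_two (by linarith), ?_⟩
  rw [Real.logb_le_iff_le_rpow one_lt_two (by positivity), Real.rpow_one]
  linarith

end Arithmetic

namespace IsMaximal

variable {F : Type} [Field F] [Fintype F] {m : ℕ} {s p : F[X]} {N : ℕ}

lemma le_card_monicIrreducibles_add_two (hN : 2 ≤ N) :
    N ≤ (monicIrreducibles F (N + 2)).card :=
  le_card_monicIrreducibles (by omega)
    ((two_mul_mul_le_two_pow hN).trans (Nat.pow_le_pow_left Fintype.one_lt_card _))

lemma natDegree_le (hs : IsMaximal m s) (hp : p.Monic) (hpi : Irreducible p) (hps : p ∣ s)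
    (hN : 2 ≤ N) (hmN : m < Fintype.card F ^ (N + 1)) (hd : 5 ≤ p.natDegree)
    (hpow : (Fintype.card F * N) ^ 5 ≤ Fintype.card F ^ p.natDegree) :
    (p.natDegree : ℝ) ≤ Real.logb 2 (1 + 1 / (multiplicity p s : ℝ)) * N + 3 := by
  have hr : 1 ≤ multiplicity p s := multiplicity_pos_of_dvd hps
  have hdN := hs.natDegree_le_of_dvd (by omega) hmN hp hpi hps
  obtain ⟨d, hd'⟩ : ∃ d, p.natDegree = d + 1 := ⟨p.natDegree - 1, by omega⟩
  rw [hd'] at hpow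
  have key := hs.logb_exchange (a := d) (b := N + 2) (i := multiplicity p s) (j := 0) (by omega)
    (le_card_monicIrreducibles (by omega)
      (two_mul_mul_le_pow_of_pow_le Fintype.one_lt_card hN hpow (by omega)))
    ((by omega : d ≤ N).trans (le_card_monicIrreducibles_add_two hN)) hr
    (fun t ht => by
      obtain ⟨h₁, h₂, h₃⟩ := mem_monicIrreducibles.1 ht
      exact hs.multiplicity_le_of_natDegree_lt hp hpi h₁ h₂ (by omega))
    (fun t ht => by
      obtain ⟨h₁, h₂, h₃⟩ := mem_monicIrreducibles.1 ht
      exact (hs.multiplicity_eq_zero_of_lt_natDegree (by omega) hmN h₁ h₂ (by omega)).le)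
  have hone : Real.logb 2 (1 + 1 / ((0 : ℕ) + 1 : ℝ)) = 1 := by
    norm_num
  obtain ⟨k, hk⟩ : ∃ k, multiplicity p s = k + 1 := ⟨multiplicity p s - 1, by omega⟩
  have hle := (logb_two_one_add_mem_Icc (Nat.cast_nonneg k)).2
  rw [hone] at key
  rw [hk] at key ⊢
  rw [hd']
  push_cast at key ⊢
  linarith

lemma lt_natDegree (hs : IsMaximal m s) (hp : p.Monic) (hpi : Irreducible p)
    (hN : 2 ≤ N) (hmN : m < Fintype.card F ^ (N + 1)) (hNm : Fintype.card F ^ N ≤ m)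
    (hd : 5 ≤ p.natDegree)
    (hpow : (Fintype.card F * N) ^ 5 ≤ Fintype.card F ^ p.natDegree) :
    Real.logb 2 (1 + 1 / ((multiplicity p s : ℝ) + 1)) * N - 20 < p.natDegree := by
  have hq : 2 ≤ Fintype.card F := Fintype.one_lt_card
  obtain ⟨hlog₀, hlog₁⟩ := logb_two_one_add_mem_Icc (Nat.cast_nonneg (multiplicity p s))
  set c := Real.logb 2 (1 + 1 / ((multiplicity p s : ℝ) + 1))
  have hcN : c * N ≤ N := mul_le_of_le_one_left (Nat.cast_nonneg N) hlog₁
  rcases lt_or_ge N (p.natDegree + 20) with h | h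
  · have : (N : ℝ) < p.natDegree + 20 := by exact_mod_cast h
    linarith
  obtain ⟨E, rfl⟩ : ∃ E, N = E + 8 := ⟨N - 8, by omega⟩
  obtain ⟨t, ht⟩ : (monicIrreducibles F (E + 8 + 2)).Nonempty := by
    have := le_card_monicIrreducibles_add_two (F := F) hN
    exact Finset.card_pos.1 (by omega)
  obtain ⟨ht₁, ht₂, ht₃⟩ := mem_monicIrreducibles.1 ht
  have hts : ¬ t ∣ s := fun hts => by
    have := hs.natDegree_le_of_dvd (by omega) hmN ht₁ ht₂ hts
    omega
  obtain ⟨P, hP, hPi, hPs, hPE⟩ :=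
    hs.exists_irreducible_dvd_lt_natDegree (by omega) hNm ht₁ ht₂ hts ht₃
  have hsq : 2 * E * E ≤ Fintype.card F ^ E :=
    (two_mul_sq_le_two_pow (by omega)).trans (Nat.pow_le_pow_left hq E)
  have hroom := two_mul_mul_le_pow_of_pow_le (d := p.natDegree + 1) (e := p.natDegree + 1) hq hN
    (hpow.trans (Nat.pow_le_pow_right (by omega) (by omega))) (by omega)
  have key := hs.logb_exchange (a := E) (b := p.natDegree + 1) (i := 1) (j := multiplicity p s)
    (by omega)
    ((by omega : p.natDegree + 1 ≤ E).trans (le_card_monicIrreducibles (by omega) hsq))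
    ((by omega : E ≤ E + 8 + 2).trans (le_card_monicIrreducibles (by omega) hroom)) le_rfl
    (fun u hu => by
      obtain ⟨h₁, h₂, h₃⟩ := mem_monicIrreducibles.1 hu
      have := hs.multiplicity_le_of_natDegree_lt hP hPi h₁ h₂ (by omega)
      exact (multiplicity_pos_of_dvd hPs).trans_le this)
    (fun u hu => by
      obtain ⟨h₁, h₂, h₃⟩ := mem_monicIrreducibles.1 hu
      exact hs.multiplicity_le_of_natDegree_lt h₁ h₂ hp hpi (by omega))
  have hone : Real.logb 2 (1 + 1 / ((1 : ℕ) : ℝ)) = 1 := by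
    norm_num
  rw [hone] at key
  push_cast at key ⊢
  nlinarith

end IsMaximal

/-- Theorem 3: there are absolute constants `C₁, C₂ > 0` such that for every finite field
`F` (of prime-power size `q = |F|`), every integer `m ≥ q²`, every maximal `s ∈ M_m`, and
every monic irreducible factor `p` of `s` of degree `d ≥ C₁·(1 + log_q log_q m)`, writing
`r = mult_p(s)`, one has
`log₂(1 + 1/(r+1))·⌊log_q m⌋ − C₂ < d ≤ log₂(1 + 1/r)·⌊log_q m⌋ + C₂`. -/
theorem maximal_high_degree_characterization :
    ∃ C₁ C₂ : ℝ, 0 < C₁ ∧ 0 < C₂ ∧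
      ∀ (F : Type) [Field F] [Fintype F], ∀ m : ℕ, Fintype.card F ^ 2 ≤ m →
        ∀ s : F[X], IsMaximal m s →
          ∀ p : F[X], p.Monic → Irreducible p → p ∣ s →
            C₁ * (1 + Real.logb (Fintype.card F) (Real.logb (Fintype.card F) m)) ≤
              (p.natDegree : ℝ) →
            Real.logb 2 (1 + 1 / ((multiplicity p s : ℝ) + 1)) *
                (⌊Real.logb (Fintype.card F) m⌋₊ : ℝ) - C₂ < (p.natDegree : ℝ) ∧
            (p.natDegree : ℝ) ≤ Real.logb 2 (1 + 1 / (multiplicity p s : ℝ)) *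
                (⌊Real.logb (Fintype.card F) m⌋₊ : ℝ) + C₂ := by
  refine ⟨5, 20, by norm_num, by norm_num, fun F _ _ m hm s hs p hp hpi hps hd => ?_⟩
  have hq : 2 ≤ Fintype.card F := Fintype.one_lt_card
  have hq1 : (1 : ℝ) < Fintype.card F := by exact_mod_cast hq
  have hm0 : m ≠ 0 := (lt_of_lt_of_le (by positivity) hm).ne'
  have hN : 2 ≤ Nat.log (Fintype.card F) m := Nat.le_log_of_pow_le (by omega) hm
  have hpow := pow_le_pow_of_threshold hq hm hd
  have hmN := Nat.lt_pow_succ_log_self (by omega : 1 < Fintype.card F) m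
  have hNm := Nat.pow_log_le_self (Fintype.card F) hm0
  have hd5 : 5 ≤ p.natDegree := by
    rw [← Nat.pow_le_pow_iff_right (by omega : 1 < Fintype.card F)]
    exact (Nat.pow_le_pow_left (Nat.le_mul_of_pos_right _ (by omega)) 5).trans hpow
  rw [Real.natFloor_logb_natCast]
  refine ⟨hs.lt_natDegree hp hpi hN hmN hNm hd5 hpow, ?_⟩
  have := hs.natDegree_le hp hpi hps hN hmN hd5 hpow
  linarith
end
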